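/- arXiv:1606.04020 — 4 statements merged into one kernel-verified Lean document; each statement's English description precedes it below -/
import Mathlib

section
/- Let R > 0, κ > 0, B > 0. For 0 < r < R and −1 < μ < 1 define G(r,μ) = √(1 − (r/R)²(1 − μ²)) and s(r,μ) = rμ + R·G(r,μ). Then s satisfies the first-order equation μ ∂_r s + ((1 − μ²)/r) ∂_μ s = 1, and consequently f(r,μ) = B(1 − e^{−κ s(r,μ)}) satisfies the stationary radiative transfer equation inside the homogeneous sphere: μ ∂_r f + ((1 − μ²)/r) ∂_μ f = κ(B − f). -/
/-- The radicand of `G(r,μ)` is positive inside the sphere. -/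
theorem sphere_radicand_pos {R r μ : ℝ} (hr : r ∈ Set.Ioo 0 R) :
    0 < 1 - (r / R) ^ 2 * (1 - μ ^ 2) := by
  have hR : 0 < R := hr.1.trans hr.2
  have h0 : 0 < r / R := div_pos hr.1 hR
  have h1 : r / R < 1 := (div_lt_one hR).2 hr.2
  have h2 : (r / R) ^ 2 < 1 := by nlinarith
  nlinarith [mul_nonneg (sq_nonneg (r / R)) (sq_nonneg μ)]

/-- Radial derivative of the chord length. -/
theorem hasDerivAt_chord_radius {R r μ : ℝ} (hr : r ∈ Set.Ioo 0 R) :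
    HasDerivAt (fun x : ℝ => x * μ + R * Real.sqrt (1 - (x / R) ^ 2 * (1 - μ ^ 2)))
      (μ - r * (1 - μ ^ 2) / (R * Real.sqrt (1 - (r / R) ^ 2 * (1 - μ ^ 2)))) r := by
  have hR : R ≠ 0 := (hr.1.trans hr.2).ne'
  have hpos := sphere_radicand_pos (μ := μ) hr
  have hG := (Real.sqrt_pos.2 hpos).ne'
  have hrad := ((((hasDerivAt_id r).div_const R).pow 2).mul_const (1 - μ ^ 2)).const_sub 1
  refine (((hasDerivAt_id r).mul_const μ).add
    ((hrad.sqrt hpos.ne').const_mul R)).congr_deriv ?_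
  simp only [id, Pi.pow_apply, Nat.add_one_sub_one, pow_one]
  generalize Real.sqrt _ = G at hG ⊢
  field_simp
  ring

/-- Angular derivative of the chord length. -/
theorem hasDerivAt_chord_angle {R r μ : ℝ} (hr : r ∈ Set.Ioo 0 R) :
    HasDerivAt (fun x : ℝ => r * x + R * Real.sqrt (1 - (r / R) ^ 2 * (1 - x ^ 2)))
      (r + r ^ 2 * μ / (R * Real.sqrt (1 - (r / R) ^ 2 * (1 - μ ^ 2)))) μ := by
  have hR : R ≠ 0 := (hr.1.trans hr.2).ne'
  have hpos := sphere_radicand_pos (μ := μ) hr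
  have hG := (Real.sqrt_pos.2 hpos).ne'
  have hrad := ((((hasDerivAt_id μ).pow 2).const_sub 1).const_mul ((r / R) ^ 2)).const_sub 1
  refine (((hasDerivAt_id μ).const_mul r).add
    ((hrad.sqrt hpos.ne').const_mul R)).congr_deriv ?_
  simp only [id, Pi.pow_apply, Nat.add_one_sub_one, pow_one]
  generalize Real.sqrt _ = G at hG ⊢
  field_simp
  ring

/-- Chain rule for the attenuation profile `B (1 - e^{-κ g})`. -/
theorem HasDerivAt.attenuation {g : ℝ → ℝ} {g' x : ℝ} (hg : HasDerivAt g g' x) (κ B : ℝ) :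
    HasDerivAt (fun y => B * (1 - Real.exp (-κ * g y)))
      (B * κ * Real.exp (-κ * g x) * g') x :=
  (((hg.const_mul (-κ)).exp.const_sub 1).const_mul B).congr_deriv (by ring)

/-- Inside the homogeneous sphere, `s(r,μ) = rμ + R G(r,μ)` with
`G(r,μ) = √(1 - (r/R)² (1 - μ²))` satisfies `μ ∂_r s + ((1-μ²)/r) ∂_μ s = 1`,
hence `f = B (1 - e^{-κ s})` satisfies the stationary radiative transfer
equation `μ ∂_r f + ((1-μ²)/r) ∂_μ f = κ (B - f)`. -/
theorem homogeneous_sphere_interior_solution (R κ B : ℝ) (hR : 0 < R)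
    (hκ : 0 < κ) (hB : 0 < B)
    (s : ℝ → ℝ → ℝ)
    (hs : s = fun r μ => r * μ + R * Real.sqrt (1 - (r / R) ^ 2 * (1 - μ ^ 2)))
    (f : ℝ → ℝ → ℝ)
    (hf : f = fun r μ => B * (1 - Real.exp (-κ * s r μ))) :
    ∀ r ∈ Set.Ioo 0 R, ∀ μ ∈ Set.Ioo (-1 : ℝ) 1,
      (μ * deriv (fun r' => s r' μ) r + (1 - μ ^ 2) / r * deriv (s r) μ = 1) ∧
      (μ * deriv (fun r' => f r' μ) r + (1 - μ ^ 2) / r * deriv (f r) μ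
        = κ * (B - f r μ)) := by
  subst hs
  subst hf
  intro r hr μ _
  have hdr := hasDerivAt_chord_radius (μ := μ) hr
  have hdμ := hasDerivAt_chord_angle (μ := μ) hr
  have hR0 : R ≠ 0 := hR.ne'
  have hr0 : r ≠ 0 := hr.1.ne'
  have hG := (Real.sqrt_pos.2 (sphere_radicand_pos (μ := μ) hr)).ne'
  have transport :
      μ * (μ - r * (1 - μ ^ 2) / (R * Real.sqrt (1 - (r / R) ^ 2 * (1 - μ ^ 2)))) +
        (1 - μ ^ 2) / r *
          (r + r ^ 2 * μ / (R * Real.sqrt (1 - (r / R) ^ 2 * (1 - μ ^ 2)))) = 1 := by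
    generalize Real.sqrt _ = G at hG ⊢
    field_simp
    ring
  constructor
  · rw [hdr.deriv, hdμ.deriv, transport]
  · rw [(hdr.attenuation κ B).deriv, (hdμ.attenuation κ B).deriv]
    linear_combination
      B * κ * Real.exp (-κ * (r * μ + R * Real.sqrt (1 - (r / R) ^ 2 * (1 - μ ^ 2)))) *
        transport
end

section
/- Let R > 0, B > 0. For the homogeneous sphere, the zeroth angular moment J(r; κ) satisfies: for every fixed r with 0 < r < R, lim_{κ→∞} J(r;κ) = B, and for every fixed r ≥ R, lim_{κ→∞} J(r;κ) = (B/2)·[1 − √(1 − (R/r)²)]. -/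
open intervalIntegral Filter

/-- An integral over a bounded interval of functions dominated by `exp (-κ g)` with `g > 0`
tends to zero as `κ → ∞`. -/
theorem tendsto_integral_zero_of_le_exp {a b : ℝ} {F : ℝ → ℝ → ℝ} {g : ℝ → ℝ}
    (hF : ∀ κ, Continuous (F κ)) (hg : ∀ μ ∈ Set.uIoc a b, 0 < g μ)
    (hFg : ∀ κ, 0 ≤ κ → ∀ μ ∈ Set.uIoc a b, |F κ μ| ≤ Real.exp (-(κ * g μ))) :
    Tendsto (fun κ => ∫ μ in a..b, F κ μ) atTop (nhds 0) := by
  have key : Tendsto (fun κ => ∫ μ in a..b, F κ μ) atTop (nhds (∫ _ in a..b, (0 : ℝ))) := by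
    refine tendsto_integral_filter_of_dominated_convergence (fun _ => 1)
      (Eventually.of_forall fun κ => (hF κ).aestronglyMeasurable) ?_
      intervalIntegrable_const (Eventually.of_forall fun μ hμ => ?_)
    · filter_upwards [eventually_ge_atTop 0] with κ hκ
      refine Eventually.of_forall fun μ hμ => (hFg κ hκ μ hμ).trans ?_
      rw [Real.exp_le_one_iff, neg_nonpos]
      exact mul_nonneg hκ (hg μ hμ).le
    · refine squeeze_zero_norm' ?_
        (Real.tendsto_exp_neg_atTop_nhds_zero.comp (tendsto_id.atTop_mul_const (hg μ hμ)))
      filter_upwards [eventually_ge_atTop 0] with κ hκ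
      exact hFg κ hκ μ hμ
  simpa using key

theorem cosh_le_exp_of_nonneg {x : ℝ} (hx : 0 ≤ x) : Real.cosh x ≤ Real.exp x := by
  rw [← Real.cosh_add_sinh]
  linarith [Real.sinh_nonneg_iff.2 hx]

theorem mul_lt_mul_sqrt_of_lt {r R μ : ℝ} (hr : 0 < r) (hrR : r < R) :
    r * μ < R * Real.sqrt (1 - (r / R) ^ 2 * (1 - μ ^ 2)) := by
  have hR : 0 < R := hr.trans hrR
  rw [mul_comm R, ← div_lt_iff₀ hR]
  refine Real.lt_sqrt_of_sq_lt ?_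
  have h : (r / R) ^ 2 < 1 := by
    rw [sq_lt_one_iff₀ (by positivity)]
    exact (div_lt_one hR).2 hrR
  have e : (r * μ / R) ^ 2 = (r / R) ^ 2 * μ ^ 2 := by ring
  rw [e]
  linarith

theorem sqrt_pos_of_sqrt_lt {r R μ : ℝ} (hR : 0 < R) (hr : 0 < r)
    (hμ : Real.sqrt (1 - (R / r) ^ 2) < μ) :
    0 < Real.sqrt (1 - (r / R) ^ 2 * (1 - μ ^ 2)) := by
  rw [Real.sqrt_pos, sub_pos]
  have h : 1 - μ ^ 2 < (R / r) ^ 2 := by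
    linarith [(Real.sqrt_lt' ((Real.sqrt_nonneg _).trans_lt hμ)).1 hμ]
  calc (r / R) ^ 2 * (1 - μ ^ 2) < (r / R) ^ 2 * (R / r) ^ 2 := by gcongr
    _ = 1 := by field_simp

/-- The zeroth angular moment of the homogeneous sphere solution converges, as
`κ → ∞`, to `B` inside the sphere and to `(B/2)(1 - √(1-(R/r)²))` outside. -/
theorem homogeneous_sphere_J_limit (R B : ℝ) (hR : 0 < R) (hB : 0 < B)
    (J : ℝ → ℝ → ℝ)
    (hJin : ∀ κ : ℝ, ∀ r, 0 < r → r < R →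
      J r κ = B * (1 - ∫ μ in (0:ℝ)..1,
        Real.cosh (κ * r * μ) *
          Real.exp (-(κ * R) * Real.sqrt (1 - (r / R) ^ 2 * (1 - μ ^ 2)))))
    (hJout : ∀ κ : ℝ, ∀ r, R ≤ r →
      J r κ = (B / 2) * (1 - Real.sqrt (1 - (R / r) ^ 2)
        - ∫ μ in Real.sqrt (1 - (R / r) ^ 2)..1,
            Real.exp (-(2 * κ * R) * Real.sqrt (1 - (r / R) ^ 2 * (1 - μ ^ 2))))) :
    (∀ r, 0 < r → r < R → Tendsto (fun κ => J r κ) atTop (nhds B)) ∧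
    (∀ r, R ≤ r → Tendsto (fun κ => J r κ) atTop
      (nhds ((B / 2) * (1 - Real.sqrt (1 - (R / r) ^ 2))))) := by
  constructor
  · intro r hr hrR
    simp only [hJin _ r hr hrR]
    have h := tendsto_integral_zero_of_le_exp (a := 0) (b := 1)
      (F := fun κ μ => Real.cosh (κ * r * μ) *
          Real.exp (-(κ * R) * Real.sqrt (1 - (r / R) ^ 2 * (1 - μ ^ 2))))
      (g := fun μ => R * Real.sqrt (1 - (r / R) ^ 2 * (1 - μ ^ 2)) - r * μ)
      (fun κ => by fun_prop) ?_ ?_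
    · simpa using (h.const_sub 1).const_mul B
    · intro μ _
      exact sub_pos.2 (mul_lt_mul_sqrt_of_lt hr hrR)
    · intro κ hκ μ hμ
      rw [Set.uIoc_of_le zero_le_one] at hμ
      have hμ0 := hμ.1
      rw [abs_of_nonneg (mul_nonneg (Real.cosh_pos _).le (Real.exp_pos _).le)]
      calc _ ≤ Real.exp (κ * r * μ) *
            Real.exp (-(κ * R) * Real.sqrt (1 - (r / R) ^ 2 * (1 - μ ^ 2))) := by
            gcongr
            exact cosh_le_exp_of_nonneg (by positivity)
        _ = _ := by
            rw [← Real.exp_add]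
            congr 1
            ring
  · intro r hr
    have hr0 : 0 < r := hR.trans_le hr
    simp only [hJout _ r hr]
    have hle : Real.sqrt (1 - (R / r) ^ 2) ≤ 1 :=
      Real.sqrt_le_one.2 (sub_le_self _ (sq_nonneg _))
    have h := tendsto_integral_zero_of_le_exp (a := Real.sqrt (1 - (R / r) ^ 2)) (b := 1)
      (F := fun κ μ => Real.exp (-(2 * κ * R) * Real.sqrt (1 - (r / R) ^ 2 * (1 - μ ^ 2))))
      (g := fun μ => 2 * R * Real.sqrt (1 - (r / R) ^ 2 * (1 - μ ^ 2)))
      (fun κ => by fun_prop) ?_ ?_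
    · simpa using (h.const_sub (1 - Real.sqrt (1 - (R / r) ^ 2))).const_mul (B / 2)
    · intro μ hμ
      rw [Set.uIoc_of_le hle] at hμ
      exact mul_pos (by positivity) (sqrt_pos_of_sqrt_lt hR hr0 hμ.1)
    · intro κ _ μ _
      rw [Real.abs_exp]
      refine (congrArg Real.exp ?_).le
      ring
end

section
/- Let R > 0, B > 0. For the homogeneous sphere, the first and second angular moments H(r;κ) and K(r;κ) satisfy: for every fixed r with 0 < r < R, lim_{κ→∞} H(r;κ) = 0 and lim_{κ→∞} K(r;κ) = B/3, and for every fixed r ≥ R, lim_{κ→∞} H(r;κ) = (B/4)·(R/r)² and lim_{κ→∞} K(r;κ) = (B/6)·[1 − (1 − (R/r)²)^{3/2}]. -/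
open intervalIntegral Filter

/-- A family of functions dominated by `exp (-κ c)` with `c > 0` has integrals tending to `0`
as `κ → ∞`. -/
theorem tendsto_intervalIntegral_zero_of_abs_le_exp {a b : ℝ} (hab : a ≤ b)
    {f : ℝ → ℝ → ℝ} {c : ℝ → ℝ} (hf : ∀ κ, Continuous (f κ))
    (hc : ∀ μ ∈ Set.Ioc a b, 0 < c μ)
    (hfc : ∀ κ, 0 ≤ κ → ∀ μ ∈ Set.Ioc a b, |f κ μ| ≤ Real.exp (-(κ * c μ))) :
    Tendsto (fun κ => ∫ μ in a..b, f κ μ) atTop (nhds 0) := by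
  have key : Tendsto (fun κ => ∫ μ in a..b, f κ μ) atTop (nhds (∫ _ in a..b, (0 : ℝ))) := by
    refine tendsto_integral_filter_of_dominated_convergence (fun _ => (1 : ℝ)) ?_ ?_ ?_ ?_
    · exact Eventually.of_forall fun κ => (hf κ).aestronglyMeasurable
    · filter_upwards [eventually_ge_atTop (0 : ℝ)] with κ hκ
      refine Eventually.of_forall fun μ hμ => ?_
      rw [Set.uIoc_of_le hab] at hμ
      refine (hfc κ hκ μ hμ).trans (Real.exp_le_one_iff.mpr ?_)
      have := mul_nonneg hκ (hc μ hμ).le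
      linarith
    · exact intervalIntegrable_const
    · refine Eventually.of_forall fun μ hμ => ?_
      rw [Set.uIoc_of_le hab] at hμ
      refine squeeze_zero_norm' (a := fun κ => Real.exp (-(κ * c μ))) ?_ ?_
      · filter_upwards [eventually_ge_atTop (0 : ℝ)] with κ hκ using hfc κ hκ μ hμ
      · exact Real.tendsto_exp_neg_atTop_nhds_zero.comp (tendsto_id.atTop_mul_const (hc μ hμ))
  simpa using key

/-- Inside the sphere, the exit optical depth strictly exceeds the radial projection. -/
theorem mul_lt_mul_sqrt_one_sub {R r μ : ℝ} (hr : 0 < r) (hrR : r < R) :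
    r * μ < R * Real.sqrt (1 - (r / R) ^ 2 * (1 - μ ^ 2)) := by
  have hR : 0 < R := hr.trans hrR
  have h : r * μ / R < Real.sqrt (1 - (r / R) ^ 2 * (1 - μ ^ 2)) := by
    apply Real.lt_sqrt_of_sq_lt
    have h1 : (r / R) ^ 2 < 1 := by
      have := (div_lt_one hR).mpr hrR
      have := div_pos hr hR
      nlinarith
    have h2 : (r * μ / R) ^ 2 = (r / R) ^ 2 * μ ^ 2 := by ring
    rw [h2]
    linarith
  rw [div_lt_iff₀ hR] at h
  linarith

/-- Outside the sphere, the chord length is positive for directions hitting the sphere. -/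
theorem sqrt_one_sub_pos_of_lt {R r μ : ℝ} (hR : 0 < R) (hr : R ≤ r)
    (hμ : Real.sqrt (1 - (R / r) ^ 2) < μ) :
    0 < Real.sqrt (1 - (r / R) ^ 2 * (1 - μ ^ 2)) := by
  have hr0 : 0 < r := hR.trans_le hr
  have h1 : 1 - (R / r) ^ 2 < μ ^ 2 := Real.lt_sq_of_sqrt_lt hμ
  have h2 : (r / R) ^ 2 * (R / r) ^ 2 = 1 := by field_simp
  have h3 : 0 < (r / R) ^ 2 := by positivity
  apply Real.sqrt_pos.mpr
  nlinarith

theorem cosh_mul_exp_le {κ R r μ s : ℝ} (hx : 0 ≤ κ * r * μ) :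
    Real.cosh (κ * r * μ) * Real.exp (-(κ * R) * s) ≤ Real.exp (-(κ * (R * s - r * μ))) := by
  have h : Real.cosh (κ * r * μ) ≤ Real.exp (κ * r * μ) := by
    rw [← Real.cosh_add_sinh]
    linarith [Real.sinh_nonneg_iff.mpr hx]
  calc _ ≤ Real.exp (κ * r * μ) * Real.exp (-(κ * R) * s) := by gcongr
    _ = _ := by rw [← Real.exp_add]; ring_nf

theorem tendsto_integral_inside {R r : ℝ} (hr : 0 < r) (hrR : r < R) {g : ℝ → ℝ → ℝ}
    (hg : ∀ κ, Continuous (g κ))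
    (hgc : ∀ κ, 0 ≤ κ → ∀ μ ∈ Set.Ioc (0 : ℝ) 1, |g κ μ| ≤ Real.cosh (κ * r * μ)) :
    Tendsto (fun κ => ∫ μ in (0:ℝ)..1,
      g κ μ * Real.exp (-(κ * R) * Real.sqrt (1 - (r / R) ^ 2 * (1 - μ ^ 2))))
      atTop (nhds 0) := by
  refine tendsto_intervalIntegral_zero_of_abs_le_exp zero_le_one
    (c := fun μ => R * Real.sqrt (1 - (r / R) ^ 2 * (1 - μ ^ 2)) - r * μ) ?_ ?_ ?_
  · intro κ
    have := hg κ
    fun_prop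
  · exact fun _ _ => sub_pos.mpr (mul_lt_mul_sqrt_one_sub hr hrR)
  · intro κ hκ μ hμ
    rw [abs_mul, Real.abs_exp]
    refine le_trans ?_ (cosh_mul_exp_le (mul_nonneg (mul_nonneg hκ hr.le) hμ.1.le))
    gcongr
    exact hgc κ hκ μ hμ

theorem tendsto_integral_outside {R r : ℝ} (hR : 0 < R) (hr : R ≤ r) {g : ℝ → ℝ}
    (hg : Continuous g) (hg1 : ∀ μ ∈ Set.Icc (0 : ℝ) 1, |g μ| ≤ 1) :
    Tendsto (fun κ => ∫ μ in Real.sqrt (1 - (R / r) ^ 2)..1,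
      g μ * Real.exp (-(2 * κ * R) * Real.sqrt (1 - (r / R) ^ 2 * (1 - μ ^ 2))))
      atTop (nhds 0) := by
  refine tendsto_intervalIntegral_zero_of_abs_le_exp
    (c := fun μ => 2 * R * Real.sqrt (1 - (r / R) ^ 2 * (1 - μ ^ 2))) ?_ ?_ ?_ ?_
  · exact Real.sqrt_le_one.mpr (by linarith [sq_nonneg (R / r)])
  · intro κ
    fun_prop
  · exact fun μ hμ => mul_pos (by positivity) (sqrt_one_sub_pos_of_lt hR hr hμ.1)
  · intro κ hκ μ hμ
    rw [abs_mul, Real.abs_exp]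
    refine (mul_le_of_le_one_left (Real.exp_pos _).le
      (hg1 μ ⟨(Real.sqrt_nonneg _).trans hμ.1.le, hμ.2⟩)).trans (le_of_eq ?_)
    ring_nf

/-- The first and second angular moments of the homogeneous sphere solution
converge, as `κ → ∞`, to `0` and `B/3` inside the sphere, and to
`(B/4)(R/r)²` and `(B/6)(1 - (1-(R/r)²)^{3/2})` outside. -/
theorem homogeneous_sphere_HK_limit (R B : ℝ) (hR : 0 < R) (hB : 0 < B)
    (H K : ℝ → ℝ → ℝ)
    (hHin : ∀ κ : ℝ, ∀ r, 0 < r → r < R →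
      H r κ = B * ∫ μ in (0:ℝ)..1,
        μ * Real.sinh (κ * r * μ) *
          Real.exp (-(κ * R) * Real.sqrt (1 - (r / R) ^ 2 * (1 - μ ^ 2))))
    (hKin : ∀ κ : ℝ, ∀ r, 0 < r → r < R →
      K r κ = B * (1 / 3 - ∫ μ in (0:ℝ)..1,
        μ ^ 2 * Real.cosh (κ * r * μ) *
          Real.exp (-(κ * R) * Real.sqrt (1 - (r / R) ^ 2 * (1 - μ ^ 2)))))
    (hHout : ∀ κ : ℝ, ∀ r, R ≤ r →
      H r κ = (B / 2) * ((1 / 2) * (R / r) ^ 2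
        - ∫ μ in Real.sqrt (1 - (R / r) ^ 2)..1,
            μ * Real.exp (-(2 * κ * R) * Real.sqrt (1 - (r / R) ^ 2 * (1 - μ ^ 2)))))
    (hKout : ∀ κ : ℝ, ∀ r, R ≤ r →
      K r κ = (B / 6) * (1 - (1 - (R / r) ^ 2) ^ ((3 : ℝ) / 2)
        - 3 * ∫ μ in Real.sqrt (1 - (R / r) ^ 2)..1,
            μ ^ 2 * Real.exp (-(2 * κ * R) * Real.sqrt (1 - (r / R) ^ 2 * (1 - μ ^ 2))))) :
    (∀ r, 0 < r → r < R → Tendsto (fun κ => H r κ) atTop (nhds 0)) ∧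
    (∀ r, 0 < r → r < R → Tendsto (fun κ => K r κ) atTop (nhds (B / 3))) ∧
    (∀ r, R ≤ r → Tendsto (fun κ => H r κ) atTop
      (nhds ((B / 4) * (R / r) ^ 2))) ∧
    (∀ r, R ≤ r → Tendsto (fun κ => K r κ) atTop
      (nhds ((B / 6) * (1 - (1 - (R / r) ^ 2) ^ ((3 : ℝ) / 2))))) := by
  refine ⟨fun r h0 h1 => ?_, fun r h0 h1 => ?_, fun r h => ?_, fun r h => ?_⟩
  · have key := (tendsto_integral_inside h0 h1 (g := fun κ μ => μ * Real.sinh (κ * r * μ))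
      (fun κ => by fun_prop) (fun κ hκ μ hμ => by
        have hs : 0 ≤ Real.sinh (κ * r * μ) :=
          Real.sinh_nonneg_iff.mpr (mul_nonneg (mul_nonneg hκ h0.le) hμ.1.le)
        rw [abs_of_nonneg (mul_nonneg hμ.1.le hs)]
        exact (mul_le_of_le_one_left hs hμ.2).trans (Real.sinh_lt_cosh _).le)).const_mul B
    rw [mul_zero] at key
    exact key.congr fun κ => (hHin κ r h0 h1).symm
  · have key := ((tendsto_integral_inside h0 h1 (g := fun κ μ => μ ^ 2 * Real.cosh (κ * r * μ))
      (fun κ => by fun_prop) (fun κ hκ μ hμ => by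
        have hs := (Real.cosh_pos (κ * r * μ)).le
        rw [abs_of_nonneg (mul_nonneg (sq_nonneg μ) hs)]
        exact mul_le_of_le_one_left hs (pow_le_one₀ hμ.1.le hμ.2))).const_sub (1 / 3)).const_mul B
    rw [show B * (1 / 3 - 0) = B / 3 by ring] at key
    exact key.congr fun κ => (hKin κ r h0 h1).symm
  · have key := ((tendsto_integral_outside hR h (g := fun μ => μ) continuous_id
      (fun μ hμ => by rw [abs_of_nonneg hμ.1]; exact hμ.2)).const_sub
        ((1 / 2) * (R / r) ^ 2)).const_mul (B / 2)
    rw [show B / 2 * (1 / 2 * (R / r) ^ 2 - 0) = B / 4 * (R / r) ^ 2 by ring] at key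
    exact key.congr fun κ => (hHout κ r h).symm
  · have key := (((tendsto_integral_outside hR h (g := fun μ => μ ^ 2) (continuous_pow 2)
      (fun μ hμ => by
        rw [abs_of_nonneg (sq_nonneg μ)]
        exact pow_le_one₀ hμ.1 hμ.2)).const_mul 3).const_sub
          (1 - (1 - (R / r) ^ 2) ^ ((3 : ℝ) / 2))).const_mul (B / 6)
    rw [mul_zero, sub_zero] at key
    exact key.congr fun κ => (hKout κ r h).symm
end

section
/- Let R > 0, κ > 0, B > 0. Then the function J^t(r) = B·(1 − (R/r)·sinh(√3 κ r)/sinh(√3 κ R)) satisfies, for all r ∈ (0, R), the stationary diffusion equation −(1/r²)·d/dr( (r²/(3κ))·dJ^t/dr ) = κ·(B − J^t(r)), with boundary value J^t(R) = 0. -/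
/-- The derivative of `r ↦ B (1 - (R/r) sinh(a r)/S)` away from the origin. -/
theorem hasDerivAt_one_sub_div_mul_sinh (R B S a : ℝ) {r : ℝ} (hr : r ≠ 0) :
    HasDerivAt (fun r => B * (1 - (R / r) * Real.sinh (a * r) / S))
      (-(B * R / S) * (a * r * Real.cosh (a * r) - Real.sinh (a * r)) / r ^ 2) r := by
  have hlin : HasDerivAt (fun r : ℝ => a * r) a r := by
    simpa using (hasDerivAt_id r).const_mul a
  have hinv : HasDerivAt (fun r : ℝ => R / r) (R * -(r ^ 2)⁻¹) r := by
    simpa [div_eq_mul_inv] using (hasDerivAt_inv hr).const_mul R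
  refine ((((hinv.mul hlin.sinh).div_const S).const_sub 1).const_mul B).congr_deriv ?_
  field_simp
  ring

/-- The derivative of `r ↦ a r cosh(a r) - sinh(a r)`. -/
theorem hasDerivAt_mul_cosh_sub_sinh (a r : ℝ) :
    HasDerivAt (fun r => a * r * Real.cosh (a * r) - Real.sinh (a * r))
      (a ^ 2 * r * Real.sinh (a * r)) r := by
  have hlin : HasDerivAt (fun r : ℝ => a * r) a r := by
    simpa using (hasDerivAt_id r).const_mul a
  refine ((hlin.mul hlin.cosh).sub hlin.sinh).congr_deriv ?_
  ring

/-- The closed-form trapped solution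
`J^t(r) = B (1 - (R/r) sinh(√3 κ r)/sinh(√3 κ R))` satisfies the stationary
diffusion equation `-(1/r²) d/dr((r²/(3κ)) dJ^t/dr) = κ (B - J^t)` on `(0,R)`,
with boundary value `J^t(R) = 0`. -/
theorem new_idsa_stationary_solution (R κ B : ℝ) (hR : 0 < R) (hκ : 0 < κ)
    (hB : 0 < B) (Jt : ℝ → ℝ)
    (hJt : Jt = fun r => B * (1 - (R / r) *
        Real.sinh (Real.sqrt 3 * κ * r) / Real.sinh (Real.sqrt 3 * κ * R))) :
    (∀ r ∈ Set.Ioo 0 R,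
      -(1 / r ^ 2) * deriv (fun r' => r' ^ 2 / (3 * κ) * deriv Jt r') r
        = κ * (B - Jt r)) ∧
    Jt R = 0 := by
  subst hJt
  have hS : Real.sinh (Real.sqrt 3 * κ * R) ≠ 0 :=
    (Real.sinh_pos_iff.2 (by positivity)).ne'
  refine ⟨fun r hr => ?_, ?_⟩
  · have hr0 : r ≠ 0 := hr.1.ne'
    have hflux : (fun r' => r' ^ 2 / (3 * κ) * deriv (fun r => B * (1 - (R / r) *
          Real.sinh (Real.sqrt 3 * κ * r) / Real.sinh (Real.sqrt 3 * κ * R))) r') =ᶠ[nhds r]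
        fun r' => -(B * R / Real.sinh (Real.sqrt 3 * κ * R)) / (3 * κ) *
          (Real.sqrt 3 * κ * r' * Real.cosh (Real.sqrt 3 * κ * r') -
            Real.sinh (Real.sqrt 3 * κ * r')) := by
      filter_upwards [eventually_ne_nhds hr0] with r' hr'
      rw [(hasDerivAt_one_sub_div_mul_sinh R B _ (Real.sqrt 3 * κ) hr').deriv]
      field_simp
    rw [hflux.deriv_eq, ((hasDerivAt_mul_cosh_sub_sinh (Real.sqrt 3 * κ) r).const_mul _).deriv,
      mul_pow, Real.sq_sqrt (by norm_num)]
    field_simp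
    ring
  · simp [div_self hR.ne', div_self hS]
end
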